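/- arXiv:2404.02574 — 7 statements merged into one kernel-verified Lean document; each statement's English description precedes it below -/
import Mathlib

section
/- Let the system over Z_q have relative degree ν with 1 ≤ ν ≤ n, and let T_2 ∈ Z_q^{ν×n} be the matrix whose rows are H, H·F, …, H·F^{ν−1} (mod q). Then there exists a matrix T_1 ∈ Z_q^{(n−ν)×n} such that the stacked matrix T = [T_1; T_2] ∈ Z_q^{n×n} is invertible over Z_q and T_1·G ≡ 0 (mod q); consequently T·G ≡ [0_{(n−1)×1}; g] (mod q), where g = H·F^{ν−1}·G mod q. -/
open Matrix

/-- A matrix over a field with a right inverse extends to an invertible square matrix whose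
inverse extends the given right inverse. -/
theorem Matrix.exists_block_inverse_of_mul_eq_one {K : Type*} [Field K] {n m : ℕ}
    (A : Matrix (Fin m) (Fin n) K) (B : Matrix (Fin n) (Fin m) K) (h : A * B = 1) :
    ∃ (T : Matrix (Fin (n - m)) (Fin n) K) (V : Matrix (Fin n) (Fin (n - m)) K),
      T * V = 1 ∧ T * B = 0 ∧ A * V = 0 ∧ V * T + B * A = 1 := by
  have hsurj : Function.Surjective A.mulVecLin := fun y => ⟨B *ᵥ y, by simp [h]⟩
  have hrank : Module.finrank K (LinearMap.ker A.mulVecLin) = n - m := by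
    have hsum := A.mulVecLin.finrank_range_add_finrank_ker
    rw [LinearMap.range_eq_top.mpr hsurj, finrank_top] at hsum
    simp only [Module.finrank_fin_fun] at hsum
    omega
  let e := (Module.finBasisOfFinrankEq K (LinearMap.ker A.mulVecLin) hrank).equivFun
  have hker (x : Fin n → K) : (1 - B * A).mulVecLin x ∈ LinearMap.ker A.mulVecLin := by
    simp [Matrix.mulVec_sub, ← Matrix.mul_assoc, h]
  let T := LinearMap.toMatrix' (e.toLinearMap ∘ₗ LinearMap.codRestrict _ _ hker)
  let V := LinearMap.toMatrix' ((LinearMap.ker A.mulVecLin).subtype ∘ₗ e.symm.toLinearMap)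
  have hTx (x : Fin n → K) : T *ᵥ x = e ⟨_, hker x⟩ := by
    simp only [T, LinearMap.toMatrix'_mulVec]
    rfl
  have hVy (y : Fin (n - m) → K) : V *ᵥ y = (e.symm y : Fin n → K) := by
    simp only [V, LinearMap.toMatrix'_mulVec]
    rfl
  have hAV : A * V = 0 := by
    refine Matrix.ext_of_mulVec_single fun i => ?_
    rw [← Matrix.mulVec_mulVec, hVy, Matrix.zero_mulVec]
    exact (e.symm (Pi.single i 1)).2
  have hVT : V * T = 1 - B * A := by
    refine Matrix.ext_of_mulVec_single fun i => ?_
    rw [← Matrix.mulVec_mulVec, hVy, hTx, LinearEquiv.symm_apply_apply]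
    rfl
  have hV : Function.Injective (V *ᵥ ·) := fun x y hxy => by
    simp only [hVy] at hxy
    exact e.symm.injective (Subtype.ext hxy)
  have cancel {k : ℕ} {X Y : Matrix (Fin (n - m)) (Fin k) K} (hXY : V * X = V * Y) : X = Y := by
    refine Matrix.ext_of_mulVec_single fun i => hV ?_
    simp [Matrix.mulVec_mulVec, hXY, -Matrix.mulVec_single]
  refine ⟨T, V, cancel ?_, cancel ?_, hAV, ?_⟩
  · rw [← Matrix.mul_assoc, hVT, Matrix.sub_mul, Matrix.mul_assoc, hAV]
    simp
  · rw [← Matrix.mul_assoc, hVT, Matrix.sub_mul, Matrix.mul_assoc, h]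
    simp
  · rw [hVT, sub_add_cancel]

/-- For a system of relative degree `1 ≤ ν ≤ n` over `ZMod q` (q prime),
with `T₂` the matrix whose rows are `H, H⋅F, …, H⋅F^(ν-1)`, there exists
`T₁ ∈ Z_q^{(n-ν)×n}` such that the stacked matrix `T = [T₁; T₂]` is invertible
(witnessed by a two-sided block inverse `V = [V₁, V₂]`) and `T₁⋅G = 0`;
consequently `T⋅G = [0_{(n-1)×1}; g]` with `g = H⋅F^(ν-1)⋅G`. -/
theorem exists_T1_stacked_invertible
    (q n ν : ℕ) (hq : Nat.Prime q) (hν : 1 ≤ ν) (hνn : ν ≤ n)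
    (F : Matrix (Fin n) (Fin n) (ZMod q)) (G H : Fin n → ZMod q) (J : ZMod q)
    (hJ : J = 0)
    (hlast : H ⬝ᵥ ((F ^ (ν - 1)) *ᵥ G) ≠ 0)
    (hzero : ∀ i : ℕ, i + 2 ≤ ν → H ⬝ᵥ ((F ^ i) *ᵥ G) = 0)
    (T2 : Matrix (Fin ν) (Fin n) (ZMod q))
    (hT2 : ∀ (i : Fin ν) (j : Fin n), T2 i j = (H ᵥ* F ^ (i : ℕ)) j) :
    ∃ (T1 : Matrix (Fin (n - ν)) (Fin n) (ZMod q))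
      (V1 : Matrix (Fin n) (Fin (n - ν)) (ZMod q))
      (V2 : Matrix (Fin n) (Fin ν) (ZMod q)),
      T1 *ᵥ G = 0 ∧
      T1 * V1 = 1 ∧ T1 * V2 = 0 ∧ T2 * V1 = 0 ∧ T2 * V2 = 1 ∧
      V1 * T1 + V2 * T2 = 1 ∧
      (∀ i : Fin ν, (T2 *ᵥ G) i =
        if (i : ℕ) = ν - 1 then H ⬝ᵥ ((F ^ (ν - 1)) *ᵥ G) else 0) := by
  have : Fact q.Prime := ⟨hq⟩
  have hmul (i : Fin ν) (k : ℕ) :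
      (T2 *ᵥ ((F ^ k) *ᵥ G)) i = H ⬝ᵥ ((F ^ ((i : ℕ) + k)) *ᵥ G) := by
    have hrow : T2 i = H ᵥ* F ^ (i : ℕ) := funext (hT2 i)
    rw [Matrix.mulVec, hrow, ← Matrix.dotProduct_mulVec, Matrix.mulVec_mulVec, ← pow_add]
  let C : Matrix (Fin n) (Fin ν) (ZMod q) :=
    Matrix.of fun i j => ((F ^ (ν - 1 - (j : ℕ))) *ᵥ G) i
  have hTC (i j : Fin ν) :
      (T2 * C) i j = H ⬝ᵥ ((F ^ ((i : ℕ) + (ν - 1 - (j : ℕ)))) *ᵥ G) := hmul i _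
  have hdet : IsUnit (T2 * C).det := by
    rw [Matrix.det_of_isLowerTriangular]
    · refine isUnit_iff_ne_zero.mpr (Finset.prod_ne_zero_iff.mpr fun i _ => ?_)
      rwa [hTC, show (i : ℕ) + (ν - 1 - (i : ℕ)) = ν - 1 by omega]
    · intro i j hij
      have hlt : (i : ℕ) < j := hij
      rw [hTC]
      exact hzero _ (by omega)
  have hinv : T2 * (C * (T2 * C)⁻¹) = 1 := by
    rw [← Matrix.mul_assoc, Matrix.mul_nonsing_inv _ hdet]
  obtain ⟨T1, V1, hTV, hTB, hAV, hone⟩ := Matrix.exists_block_inverse_of_mul_eq_one _ _ hinv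
  refine ⟨T1, V1, _, ?_, hTV, hTB, hAV, hinv, hone, fun i => ?_⟩
  · have hT1C : T1 * C = 0 := by
      rw [← Matrix.nonsing_inv_mul_cancel_right (T2 * C) (T1 * C) hdet, Matrix.mul_assoc T1, hTB,
        Matrix.zero_mul]
    have hG : G = fun i => C i ⟨ν - 1, by omega⟩ := by
      funext i
      simp [C]
    funext i
    rw [hG]
    exact congrFun (congrFun hT1C i) _
  · have hi := hmul i 0
    rw [pow_zero, Matrix.one_mulVec, add_zero] at hi
    rw [hi]
    split_ifs with h
    · rw [h]
    · exact hzero _ (by omega)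
end

section
/- Let the system over Z_q have relative degree ν ≥ 1 and adopt the coordinate-change data T_1, T_2, V_1, V_2. Then the following block identities hold mod q: (i) T_2·F·V_1 = [0_{(ν−1)×(n−ν)}; ψ] ∈ Z_q^{ν×(n−ν)}, i.e., the first ν−1 rows of T_2·F·V_1 are zero and its last row equals ψ = H·F^ν·V_1; (ii) T_2·F·V_2 = [[0_{(ν−1)×1}, I_{ν−1}]; φ] ∈ Z_q^{ν×ν}, i.e., the first ν−1 rows form the shift block [0, I_{ν−1}] and the last row equals φ = H·F^ν·V_2; (iii) H·V_1 = 0_{1×(n−ν)}; and (iv) H·V_2 = [1, 0, …, 0] ∈ Z_q^{1×ν}. -/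
open Matrix

/-- Row `i` of `T * W`, when row `i` of `T` is `H * F ^ i`. -/
theorem krylov_mul_apply {R m : Type*} [CommRing R] {n ν : ℕ}
    {F : Matrix (Fin n) (Fin n) R} {H : Fin n → R} {T : Matrix (Fin ν) (Fin n) R}
    (hT : ∀ (i : Fin ν) (j : Fin n), T i j = (H ᵥ* F ^ (i : ℕ)) j)
    (W : Matrix (Fin n) m R) (i : Fin ν) :
    (T * W) i = (H ᵥ* F ^ (i : ℕ)) ᵥ* W := by
  rw [Matrix.mul_apply_eq_vecMul, show T i = H ᵥ* F ^ (i : ℕ) from funext (hT i)]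

/-- The rows of `T * F * W` are those of `T * W` shifted by one, except for the last one,
which is `H * F ^ ν * W`. -/
theorem krylov_mul_mul_apply {R m : Type*} [CommRing R] {n ν : ℕ}
    {F : Matrix (Fin n) (Fin n) R} {H : Fin n → R} {T : Matrix (Fin ν) (Fin n) R}
    (hT : ∀ (i : Fin ν) (j : Fin n), T i j = (H ᵥ* F ^ (i : ℕ)) j)
    (W : Matrix (Fin n) m R) (i : Fin ν) :
    (T * F * W) i =
      if h : (i : ℕ) + 1 < ν then (T * W) ⟨i + 1, h⟩ else (H ᵥ* F ^ ν) ᵥ* W := by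
  have key : (T * F * W) i = (H ᵥ* F ^ ((i : ℕ) + 1)) ᵥ* W := by
    rw [Matrix.mul_assoc, krylov_mul_apply hT, ← Matrix.vecMul_vecMul,
      Matrix.vecMul_vecMul H, ← pow_succ]
  split_ifs with h
  · rw [key, krylov_mul_apply hT]
  · rw [key, show (i : ℕ) + 1 = ν by omega]

/-- Block identities of the coordinate change for a system of relative
degree `ν ≥ 1` over `ZMod q` (q prime):
(i) `T₂⋅F⋅V₁ = [0; ψ]` with `ψ = H⋅F^ν⋅V₁`;
(ii) `T₂⋅F⋅V₂ = [[0, I_{ν-1}]; φ]` with `φ = H⋅F^ν⋅V₂`;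
(iii) `H⋅V₁ = 0`; (iv) `H⋅V₂ = [1,0,…,0]`. -/
theorem block_identities_of_coordinate_change
    (q n ν : ℕ) (hq : Nat.Prime q) (hν : 1 ≤ ν) (hνn : ν ≤ n)
    (F : Matrix (Fin n) (Fin n) (ZMod q)) (G H : Fin n → ZMod q) (J : ZMod q)
    (hJ : J = 0)
    (hlast : H ⬝ᵥ ((F ^ (ν - 1)) *ᵥ G) ≠ 0)
    (hzero : ∀ i : ℕ, i + 2 ≤ ν → H ⬝ᵥ ((F ^ i) *ᵥ G) = 0)
    (T1 : Matrix (Fin (n - ν)) (Fin n) (ZMod q))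
    (T2 : Matrix (Fin ν) (Fin n) (ZMod q))
    (V1 : Matrix (Fin n) (Fin (n - ν)) (ZMod q))
    (V2 : Matrix (Fin n) (Fin ν) (ZMod q))
    (hT2 : ∀ (i : Fin ν) (j : Fin n), T2 i j = (H ᵥ* F ^ (i : ℕ)) j)
    (hT1G : T1 *ᵥ G = 0)
    (hT1V1 : T1 * V1 = 1) (hT1V2 : T1 * V2 = 0)
    (hT2V1 : T2 * V1 = 0) (hT2V2 : T2 * V2 = 1)
    (hVT : V1 * T1 + V2 * T2 = 1) :
    (∀ (i : Fin ν) (j : Fin (n - ν)),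
      (T2 * F * V1) i j = if (i : ℕ) = ν - 1 then ((H ᵥ* F ^ ν) ᵥ* V1) j else 0) ∧
    (∀ (i j : Fin ν),
      (T2 * F * V2) i j =
        if (i : ℕ) = ν - 1 then ((H ᵥ* F ^ ν) ᵥ* V2) j
        else if (j : ℕ) = (i : ℕ) + 1 then 1 else 0) ∧
    (H ᵥ* V1 = 0) ∧
    (∀ j : Fin ν, (H ᵥ* V2) j = if (j : ℕ) = 0 then 1 else 0) := by
  have first {m : Type} (W : Matrix (Fin n) m (ZMod q)) : H ᵥ* W = (T2 * W) ⟨0, hν⟩ := by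
    simp [krylov_mul_apply hT2]
  refine ⟨fun i j => ?_, fun i j => ?_, ?_, fun j => ?_⟩
  · rw [krylov_mul_mul_apply hT2]
    by_cases h : (i : ℕ) + 1 < ν
    · rw [dif_pos h, if_neg (by omega), hT2V1, Matrix.zero_apply]
    · rw [dif_neg h, if_pos (by omega)]
  · rw [krylov_mul_mul_apply hT2]
    by_cases h : (i : ℕ) + 1 < ν
    · rw [dif_pos h, if_neg (by omega), hT2V2, Matrix.one_apply]
      simp only [Fin.ext_iff, eq_comm]
    · rw [dif_neg h, if_pos (by omega)]
  · rw [first, hT2V1]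
    rfl
  · rw [first, hT2V2, Matrix.one_apply]
    simp only [Fin.ext_iff, eq_comm]
end

section
/- (Proposition 1, normal form.) Let the system over Z_q have relative degree ν ≥ 1 and adopt the coordinate-change data T_1, T_2, V_1, V_2. Define z(t) = T_1·x(t) mod q ∈ Z_q^{n−ν} and v(t) = T_2·x(t) mod q ∈ Z_q^ν along any trajectory of the system. Then, writing v(t) = [v_1(t), …, v_ν(t)]^T, the following hold mod q for all t ≥ 0: z(t+1) = F_1·z(t) + F_2·v(t); v_i(t+1) = v_{i+1}(t) for i = 1, …, ν−1; v_ν(t+1) = ψ·z(t) + φ·v(t) + g·y(t); r(t) = v_1(t); with initial values z(0) = T_1·x_0 mod q and v(0) = T_2·x_0 mod q, where F_1 = T_1·F·V_1 mod q, F_2 = T_1·F·V_2 mod q, ψ = H·F^ν·V_1 mod q, φ = H·F^ν·V_2 mod q, and g = H·F^{ν−1}·G mod q. -/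
open Matrix

/-- State trajectory of the linear system `x(t+1) = F x(t) + G y(t)` over `ZMod q`. -/
def traj (q n : ℕ) (F : Matrix (Fin n) (Fin n) (ZMod q)) (G : Fin n → ZMod q)
    (x0 : Fin n → ZMod q) (y : ℕ → ZMod q) : ℕ → Fin n → ZMod q
  | 0 => x0
  | t + 1 => F *ᵥ traj q n F G x0 y t + y t • G

/-- Output `r(t) = H x(t) + J y(t)` of the linear system over `ZMod q`. -/
def out (q n : ℕ) (F : Matrix (Fin n) (Fin n) (ZMod q)) (G H : Fin n → ZMod q)
    (J : ZMod q) (x0 : Fin n → ZMod q) (y : ℕ → ZMod q) (t : ℕ) : ZMod q :=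
  H ⬝ᵥ traj q n F G x0 y t + J * y t

/-- One step of the trajectory, observed through the row `H F ^ k`. -/
theorem vecMul_pow_dotProduct_traj_succ (q n : ℕ) (F : Matrix (Fin n) (Fin n) (ZMod q))
    (G H x0 : Fin n → ZMod q) (y : ℕ → ZMod q) (k t : ℕ) :
    (H ᵥ* F ^ k) ⬝ᵥ traj q n F G x0 y (t + 1) =
      (H ᵥ* F ^ (k + 1)) ⬝ᵥ traj q n F G x0 y t + H ⬝ᵥ (F ^ k *ᵥ G) * y t := by
  rw [traj, dotProduct_add, dotProduct_smul, dotProduct_mulVec, vecMul_vecMul, ← pow_succ,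
    ← dotProduct_mulVec H (F ^ k) G, smul_eq_mul, mul_comm (y t)]

/-- Proposition 1, normal form: with `z(t) = T₁ x(t)`, `v(t) = T₂ x(t)`,
the system of relative degree `ν ≥ 1` obeys `z(t+1) = F₁ z(t) + F₂ v(t)`,
`vᵢ(t+1) = vᵢ₊₁(t)` for `i < ν-1`, `v_ν(t+1) = ψ z(t) + φ v(t) + g y(t)`,
`r(t) = v₁(t)`, with `z(0) = T₁ x₀`, `v(0) = T₂ x₀`. -/
theorem normal_form
    (q n ν : ℕ) (hq : Nat.Prime q) (hν : 1 ≤ ν) (hνn : ν ≤ n)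
    (F : Matrix (Fin n) (Fin n) (ZMod q)) (G H : Fin n → ZMod q) (J : ZMod q)
    (hJ : J = 0)
    (hlast : H ⬝ᵥ ((F ^ (ν - 1)) *ᵥ G) ≠ 0)
    (hzero : ∀ i : ℕ, i + 2 ≤ ν → H ⬝ᵥ ((F ^ i) *ᵥ G) = 0)
    (T1 : Matrix (Fin (n - ν)) (Fin n) (ZMod q))
    (T2 : Matrix (Fin ν) (Fin n) (ZMod q))
    (V1 : Matrix (Fin n) (Fin (n - ν)) (ZMod q))
    (V2 : Matrix (Fin n) (Fin ν) (ZMod q))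
    (hT2 : ∀ (i : Fin ν) (j : Fin n), T2 i j = (H ᵥ* F ^ (i : ℕ)) j)
    (hT1G : T1 *ᵥ G = 0)
    (hT1V1 : T1 * V1 = 1) (hT1V2 : T1 * V2 = 0)
    (hT2V1 : T2 * V1 = 0) (hT2V2 : T2 * V2 = 1)
    (hVT : V1 * T1 + V2 * T2 = 1)
    (x0 : Fin n → ZMod q) (y : ℕ → ZMod q) :
    let F1 := T1 * F * V1
    let F2 := T1 * F * V2
    let ψ : Fin (n - ν) → ZMod q := (H ᵥ* F ^ ν) ᵥ* V1
    let φ : Fin ν → ZMod q := (H ᵥ* F ^ ν) ᵥ* V2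
    let g : ZMod q := H ⬝ᵥ ((F ^ (ν - 1)) *ᵥ G)
    let z : ℕ → Fin (n - ν) → ZMod q := fun t => T1 *ᵥ traj q n F G x0 y t
    let v : ℕ → Fin ν → ZMod q := fun t => T2 *ᵥ traj q n F G x0 y t
    (∀ t, z (t + 1) = F1 *ᵥ z t + F2 *ᵥ v t) ∧
    (∀ t (i : Fin ν) (h : (i : ℕ) + 1 < ν), v (t + 1) i = v t ⟨(i : ℕ) + 1, h⟩) ∧
    (∀ t, v (t + 1) ⟨ν - 1, by omega⟩ = ψ ⬝ᵥ z t + φ ⬝ᵥ v t + g * y t) ∧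
    (∀ t, out q n F G H J x0 y t = v t ⟨0, by omega⟩) ∧
    z 0 = T1 *ᵥ x0 ∧ v 0 = T2 *ᵥ x0 := by
  intro F1 F2 ψ φ g z v
  have hv : ∀ t (i : Fin ν), v t i = (H ᵥ* F ^ (i : ℕ)) ⬝ᵥ traj q n F G x0 y t := fun t i =>
    congrArg (· ⬝ᵥ traj q n F G x0 y t) (funext (hT2 i))
  have hx : ∀ t, V1 *ᵥ z t + V2 *ᵥ v t = traj q n F G x0 y t := fun t => by
    simp only [z, v, mulVec_mulVec, ← add_mulVec, hVT, one_mulVec]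
  refine ⟨fun t => ?_, fun t i h => ?_, fun t => ?_, fun t => ?_, rfl, rfl⟩
  · calc z (t + 1) = (T1 * F) *ᵥ traj q n F G x0 y t := by
          simp only [z, traj, mulVec_add, mulVec_smul, hT1G, smul_zero, add_zero, mulVec_mulVec]
      _ = F1 *ᵥ z t + F2 *ᵥ v t := by
          rw [← hx t, mulVec_add, mulVec_mulVec (z t), mulVec_mulVec (v t)]
  · rw [hv, hv, vecMul_pow_dotProduct_traj_succ, hzero i h, zero_mul, add_zero]
  · rw [hv, vecMul_pow_dotProduct_traj_succ, Nat.sub_add_cancel hν, ← hx t, dotProduct_add,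
      dotProduct_mulVec _ V1 (z t), dotProduct_mulVec _ V2 (v t)]
  · rw [hv, out, hJ, zero_mul, add_zero, pow_zero, vecMul_one]
end

section
/- (Proposition 2.) Let the system over Z_q have relative degree ν ≥ 1 and adopt the coordinate-change data T_1, T_2, V_1, V_2, with F_1 = T_1·F·V_1 mod q, ψ = H·F^ν·V_1 mod q, and g = H·F^{ν−1}·G mod q. Then the output r(t) of the system with initial state x_0 and input sequence {y(t)} satisfies r(t) = 0 for all t ≥ 0 if and only if T_2·x_0 ≡ 0 (mod q) and y(t) = −g^{−1}·ψ·F_1^t·T_1·x_0 (mod q) for all t ≥ 0, where g^{−1} ∈ Z_q is the multiplicative inverse of g. -/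
open Matrix

/-- Evolution of the functional `H Fⁱ` along a trajectory. -/
lemma dotProduct_pow_mulVec_traj_succ (q n : ℕ) (F : Matrix (Fin n) (Fin n) (ZMod q))
    (G H x0 : Fin n → ZMod q) (y : ℕ → ZMod q) (i t : ℕ) :
    H ⬝ᵥ (F ^ i *ᵥ traj q n F G x0 y (t + 1)) =
      H ⬝ᵥ (F ^ (i + 1) *ᵥ traj q n F G x0 y t) + y t * (H ⬝ᵥ (F ^ i *ᵥ G)) := by
  rw [traj, mulVec_add, mulVec_smul, mulVec_mulVec, ← pow_succ, dotProduct_add,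
    dotProduct_smul, smul_eq_mul]

/-- The kernel of a block of rows `T2` is parametrized by the complementary block `T1`. -/
lemma mulVec_mulVec_eq_self_of_mulVec_eq_zero {R k m n : Type*} [CommRing R] [Fintype k]
    [Fintype m] [Fintype n] [DecidableEq n] {T1 : Matrix k n R} {T2 : Matrix m n R}
    {V1 : Matrix n k R} {V2 : Matrix n m R} (hVT : V1 * T1 + V2 * T2 = 1)
    {x : n → R} (hx : T2 *ᵥ x = 0) : V1 *ᵥ (T1 *ᵥ x) = x := by
  simpa [add_mulVec, ← mulVec_mulVec, hx] using congrArg (· *ᵥ x) hVT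

/-- If the trajectory lies in the kernel of `T2` at all times before `t`, then the coordinates
`T1 x` evolve autonomously up to time `t`. -/
lemma mulVec_traj_eq_pow_mulVec {k m : Type*} [Fintype k] [DecidableEq k] [Fintype m]
    (q n : ℕ) (F : Matrix (Fin n) (Fin n) (ZMod q))
    (G x0 : Fin n → ZMod q) (y : ℕ → ZMod q)
    {T1 : Matrix k (Fin n) (ZMod q)} {T2 : Matrix m (Fin n) (ZMod q)}
    {V1 : Matrix (Fin n) k (ZMod q)} {V2 : Matrix (Fin n) m (ZMod q)}
    (hVT : V1 * T1 + V2 * T2 = 1) (hT1G : T1 *ᵥ G = 0) (t : ℕ)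
    (hT2 : ∀ s < t, T2 *ᵥ traj q n F G x0 y s = 0) :
    T1 *ᵥ traj q n F G x0 y t = (T1 * F * V1) ^ t *ᵥ (T1 *ᵥ x0) := by
  induction t with
  | zero => simp [traj]
  | succ t ih =>
    rw [pow_succ', ← mulVec_mulVec, ← ih fun s hs => hT2 s (by omega), ← mulVec_mulVec,
      mulVec_mulVec_eq_self_of_mulVec_eq_zero hVT (hT2 t (by omega)), traj, mulVec_add,
      mulVec_smul, hT1G, smul_zero, add_zero, mulVec_mulVec]

/-- Proposition 2: the output `r(t)` remains identically zero iff
`T₂ x₀ = 0` and `y(t) = -g⁻¹ ψ F₁ᵗ T₁ x₀` for all `t ≥ 0`. -/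
theorem output_identically_zero_iff
    (q n ν : ℕ) (hq : Nat.Prime q) (hν : 1 ≤ ν) (hνn : ν ≤ n)
    (F : Matrix (Fin n) (Fin n) (ZMod q)) (G H : Fin n → ZMod q) (J : ZMod q)
    (hJ : J = 0)
    (hlast : H ⬝ᵥ ((F ^ (ν - 1)) *ᵥ G) ≠ 0)
    (hzero : ∀ i : ℕ, i + 2 ≤ ν → H ⬝ᵥ ((F ^ i) *ᵥ G) = 0)
    (T1 : Matrix (Fin (n - ν)) (Fin n) (ZMod q))
    (T2 : Matrix (Fin ν) (Fin n) (ZMod q))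
    (V1 : Matrix (Fin n) (Fin (n - ν)) (ZMod q))
    (V2 : Matrix (Fin n) (Fin ν) (ZMod q))
    (hT2 : ∀ (i : Fin ν) (j : Fin n), T2 i j = (H ᵥ* F ^ (i : ℕ)) j)
    (hT1G : T1 *ᵥ G = 0)
    (hT1V1 : T1 * V1 = 1) (hT1V2 : T1 * V2 = 0)
    (hT2V1 : T2 * V1 = 0) (hT2V2 : T2 * V2 = 1)
    (hVT : V1 * T1 + V2 * T2 = 1)
    (x0 : Fin n → ZMod q) (y : ℕ → ZMod q) :
    let F1 := T1 * F * V1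
    let ψ : Fin (n - ν) → ZMod q := (H ᵥ* F ^ ν) ᵥ* V1
    let g : ZMod q := H ⬝ᵥ ((F ^ (ν - 1)) *ᵥ G)
    (∀ t, out q n F G H J x0 y t = 0) ↔
      (T2 *ᵥ x0 = 0 ∧
        ∀ t, y t = -(g⁻¹ * (ψ ⬝ᵥ ((F1 ^ t) *ᵥ (T1 *ᵥ x0))))) := by
  intro F1 ψ g
  subst hJ
  have := Fact.mk hq
  have hg : g ≠ 0 := hlast
  have hker (x : Fin n → ZMod q) :
      T2 *ᵥ x = 0 ↔ ∀ i < ν, H ⬝ᵥ (F ^ i *ᵥ x) = 0 := by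
    have hrow (i : Fin ν) : (T2 *ᵥ x) i = H ⬝ᵥ (F ^ (i : ℕ) *ᵥ x) := by
      rw [dotProduct_mulVec, ← funext (hT2 i)]
      rfl
    simp only [funext_iff, hrow, Pi.zero_apply]
    exact ⟨fun h i hi => h ⟨i, hi⟩, fun h i => h i i.2⟩
  have hψ (x : Fin n → ZMod q) (hx : T2 *ᵥ x = 0) :
      H ⬝ᵥ (F ^ ν *ᵥ x) = ψ ⬝ᵥ (T1 *ᵥ x) := by
    rw [← dotProduct_mulVec, mulVec_mulVec_eq_self_of_mulVec_eq_zero hVT hx,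
      dotProduct_mulVec]
  have hinput (a b : ZMod q) : a + b * g = 0 ↔ b = -(g⁻¹ * a) := by
    constructor
    · intro h
      field_simp
      linear_combination h
    · rintro rfl
      field_simp
      ring
  have hlaststep (t : ℕ) := dotProduct_pow_mulVec_traj_succ q n F G H x0 y (ν - 1) t
  rw [Nat.sub_add_cancel hν] at hlaststep
  constructor
  · intro hout
    have hzeros (i : ℕ) : i < ν → ∀ t, H ⬝ᵥ (F ^ i *ᵥ traj q n F G x0 y t) = 0 := by
      induction i with
      | zero => simpa [out] using fun _ => hout
      | succ i ih =>
        intro hi t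
        have hstep := dotProduct_pow_mulVec_traj_succ q n F G H x0 y i t
        rwa [ih (by omega), hzero i (by omega), mul_zero, add_zero, eq_comm] at hstep
    have hT2x (t : ℕ) : T2 *ᵥ traj q n F G x0 y t = 0 :=
      (hker _).2 fun i hi => hzeros i hi t
    refine ⟨hT2x 0, fun t => ?_⟩
    rw [← mulVec_traj_eq_pow_mulVec q n F G x0 y hVT hT1G t fun s _ => hT2x s,
      ← hψ _ (hT2x t), ← hinput, ← hlaststep]
    exact hzeros _ (by omega) _
  · rintro ⟨hx0, hy⟩
    have hT2x (t : ℕ) : T2 *ᵥ traj q n F G x0 y t = 0 := by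
      induction t using Nat.strong_induction_on with
      | _ t ih =>
        cases t with
        | zero => exact hx0
        | succ t =>
          have ht := ih t (by omega)
          refine (hker _).2 fun i hi => ?_
          obtain rfl | hi' : i = ν - 1 ∨ i + 2 ≤ ν := by omega
          · rw [hlaststep]
            refine (hinput _ _).2 ?_
            rw [hψ _ ht, mulVec_traj_eq_pow_mulVec q n F G x0 y hVT hT1G t
              fun s hs => ih s (by omega)]
            exact hy t
          · rw [dotProduct_pow_mulVec_traj_succ, hzero i hi', mul_zero, add_zero]
            exact (hker _).1 ht _ (by omega)
    intro t
    simpa [out] using (hker _).1 (hT2x t) 0 hν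
end

section
/- (Lemma 1.) Let the system over Z_q have relative degree ν ≥ 1 and adopt the coordinate-change data T_1, T_2, V_1, V_2, with F_1 = T_1·F·V_1 mod q, ψ = H·F^ν·V_1 mod q, and g = H·F^{ν−1}·G mod q. For any initial state x_0 ∈ Z_q^n and input sequence y: Z_{≥0} → Z_q, there exist a unique v_0 ∈ Z_q^ν and a unique sequence y': Z_{≥0} → Z_q such that S(x_0, {y(τ)}_{τ=0}^{t}) = S(V_2·v_0, {y'(τ)}_{τ=0}^{t}) for all t ≥ 0; moreover they are given by v_0 = T_2·x_0 mod q and y'(t) = y(t) + g^{−1}·ψ·F_1^t·T_1·x_0 mod q for all t ≥ 0. -/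
open Matrix

section LinearRecurrence

variable {K : Type*} [Field K] {n m ν : ℕ} {F : Matrix (Fin n) (Fin n) K}
  {G H : Fin n → K} {d : ℕ → Fin n → K} {e : ℕ → K}

theorem dotProduct_pow_mulVec_succ (hd : ∀ t, d (t + 1) = F *ᵥ d t + e t • G) (i t : ℕ) :
    H ⬝ᵥ (F ^ i *ᵥ d (t + 1)) = H ⬝ᵥ (F ^ (i + 1) *ᵥ d t) + e t * (H ⬝ᵥ (F ^ i *ᵥ G)) := by
  rw [hd, mulVec_add, mulVec_smul, mulVec_mulVec, ← pow_succ, dotProduct_add, dotProduct_smul,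
    smul_eq_mul]

/-- Below the relative degree, a vanishing output forces all the `H Fⁱ d` to vanish. -/
theorem dotProduct_pow_mulVec_eq_zero (hd : ∀ t, d (t + 1) = F *ᵥ d t + e t • G)
    (hzero : ∀ i : ℕ, i + 2 ≤ ν → H ⬝ᵥ (F ^ i *ᵥ G) = 0) (hout : ∀ t, H ⬝ᵥ d t = 0)
    {i : ℕ} (hi : i < ν) (t : ℕ) : H ⬝ᵥ (F ^ i *ᵥ d t) = 0 := by
  induction i generalizing t with
  | zero => simpa using hout t
  | succ i ih =>
    have h := dotProduct_pow_mulVec_succ (H := H) hd i t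
    rw [ih (by omega), hzero i (by omega), mul_zero, add_zero] at h
    exact h.symm

variable {T1 : Matrix (Fin m) (Fin n) K} {V1 : Matrix (Fin n) (Fin m) K}

/-- On the range of `V₁ T₁` the recurrence reduces to the zero dynamics `T₁ F V₁`. -/
theorem mulVec_succ_of_mulVec_mulVec_eq (hd : ∀ t, d (t + 1) = F *ᵥ d t + e t • G)
    (hT1G : T1 *ᵥ G = 0) {t : ℕ} (ht : V1 *ᵥ (T1 *ᵥ d t) = d t) :
    T1 *ᵥ d (t + 1) = (T1 * F * V1) *ᵥ (T1 *ᵥ d t) := by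
  rw [hd, mulVec_add, mulVec_smul, hT1G, smul_zero, add_zero, ← mulVec_mulVec, ht, mulVec_mulVec]

/-- If the output vanishes identically, the input is determined by the zero dynamics. -/
theorem input_eq_of_output_eq_zero
    (hd : ∀ t, d (t + 1) = F *ᵥ d t + e t • G) (hν : 1 ≤ ν)
    (hzero : ∀ i : ℕ, i + 2 ≤ ν → H ⬝ᵥ (F ^ i *ᵥ G) = 0) (hT1G : T1 *ᵥ G = 0)
    (hV : ∀ x, (∀ i < ν, H ⬝ᵥ (F ^ i *ᵥ x) = 0) → V1 *ᵥ (T1 *ᵥ x) = x)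
    (hout : ∀ t, H ⬝ᵥ d t = 0) (t : ℕ) :
    e t * (H ⬝ᵥ (F ^ (ν - 1) *ᵥ G)) =
      -(((H ᵥ* F ^ ν) ᵥ* V1) ⬝ᵥ ((T1 * F * V1) ^ t *ᵥ (T1 *ᵥ d 0))) := by
  have hker (t : ℕ) : V1 *ᵥ (T1 *ᵥ d t) = d t :=
    hV _ fun i hi => dotProduct_pow_mulVec_eq_zero hd hzero hout hi t
  have hT1 : T1 *ᵥ d t = (T1 * F * V1) ^ t *ᵥ (T1 *ᵥ d 0) := by
    induction t with
    | zero => simp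
    | succ t ih =>
      rw [mulVec_succ_of_mulVec_mulVec_eq hd hT1G (hker t), ih, mulVec_mulVec, ← pow_succ']
  have h := dotProduct_pow_mulVec_succ (H := H) hd (ν - 1) t
  rw [dotProduct_pow_mulVec_eq_zero hd hzero hout (by omega), Nat.sub_add_cancel hν] at h
  rw [← hT1, ← dotProduct_mulVec, hker, ← dotProduct_mulVec]
  linear_combination -h

/-- The feedback input along the zero dynamics keeps the output identically zero. -/
theorem output_eq_zero_of_input_eq
    (hd : ∀ t, d (t + 1) = F *ᵥ d t + e t • G) (hν : 1 ≤ ν)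
    (hzero : ∀ i : ℕ, i + 2 ≤ ν → H ⬝ᵥ (F ^ i *ᵥ G) = 0) (hT1G : T1 *ᵥ G = 0)
    (hV : ∀ x, (∀ i < ν, H ⬝ᵥ (F ^ i *ᵥ x) = 0) → V1 *ᵥ (T1 *ᵥ x) = x)
    (hd0 : ∀ i < ν, H ⬝ᵥ (F ^ i *ᵥ d 0) = 0)
    (he : ∀ t, e t * (H ⬝ᵥ (F ^ (ν - 1) *ᵥ G)) =
      -(((H ᵥ* F ^ ν) ᵥ* V1) ⬝ᵥ ((T1 * F * V1) ^ t *ᵥ (T1 *ᵥ d 0)))) (t : ℕ) :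
    H ⬝ᵥ d t = 0 := by
  suffices h : (∀ i < ν, H ⬝ᵥ (F ^ i *ᵥ d t) = 0) ∧
      T1 *ᵥ d t = (T1 * F * V1) ^ t *ᵥ (T1 *ᵥ d 0) by
    simpa using h.1 0 hν
  induction t with
  | zero => exact ⟨hd0, by simp⟩
  | succ t ih =>
    obtain ⟨hH, hT1⟩ := ih
    have hker := hV _ hH
    refine ⟨fun i hi => ?_, ?_⟩
    · rw [dotProduct_pow_mulVec_succ hd]
      obtain hlt | rfl : i + 1 < ν ∨ i = ν - 1 := by omega
      · rw [hH _ hlt, hzero i (by omega), mul_zero, add_zero]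
      · rw [he, ← hT1, ← dotProduct_mulVec, hker, ← dotProduct_mulVec, Nat.sub_add_cancel hν,
          add_neg_cancel]
    · rw [mulVec_succ_of_mulVec_mulVec_eq hd hT1G hker, hT1, mulVec_mulVec, ← pow_succ']

end LinearRecurrence

theorem traj_sub_succ (q n : ℕ) (F : Matrix (Fin n) (Fin n) (ZMod q)) (G : Fin n → ZMod q)
    (x x' : Fin n → ZMod q) (y y' : ℕ → ZMod q) (t : ℕ) :
    traj q n F G x y (t + 1) - traj q n F G x' y' (t + 1) =
      F *ᵥ (traj q n F G x y t - traj q n F G x' y' t) + (y t - y' t) • G := by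
  simp only [traj, mulVec_sub, sub_smul]
  abel

/-- Lemma 1: for relative degree `ν ≥ 1`, there exist a unique
`v₀ ∈ Z_q^ν` and a unique input `y'` such that `S(x₀, y) = S(V₂ v₀, y')`, given by
`v₀ = T₂ x₀` and `y'(t) = y(t) + g⁻¹ ψ F₁ᵗ T₁ x₀`. -/
theorem equivalent_initial_state_and_input
    (q n ν : ℕ) (hq : Nat.Prime q) (hν : 1 ≤ ν) (hνn : ν ≤ n)
    (F : Matrix (Fin n) (Fin n) (ZMod q)) (G H : Fin n → ZMod q) (J : ZMod q)
    (hJ : J = 0)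
    (hlast : H ⬝ᵥ ((F ^ (ν - 1)) *ᵥ G) ≠ 0)
    (hzero : ∀ i : ℕ, i + 2 ≤ ν → H ⬝ᵥ ((F ^ i) *ᵥ G) = 0)
    (T1 : Matrix (Fin (n - ν)) (Fin n) (ZMod q))
    (T2 : Matrix (Fin ν) (Fin n) (ZMod q))
    (V1 : Matrix (Fin n) (Fin (n - ν)) (ZMod q))
    (V2 : Matrix (Fin n) (Fin ν) (ZMod q))
    (hT2 : ∀ (i : Fin ν) (j : Fin n), T2 i j = (H ᵥ* F ^ (i : ℕ)) j)
    (hT1G : T1 *ᵥ G = 0)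
    (hT1V1 : T1 * V1 = 1) (hT1V2 : T1 * V2 = 0)
    (hT2V1 : T2 * V1 = 0) (hT2V2 : T2 * V2 = 1)
    (hVT : V1 * T1 + V2 * T2 = 1)
    (x0 : Fin n → ZMod q) (y : ℕ → ZMod q) :
    let F1 := T1 * F * V1
    let ψ : Fin (n - ν) → ZMod q := (H ᵥ* F ^ ν) ᵥ* V1
    let g : ZMod q := H ⬝ᵥ ((F ^ (ν - 1)) *ᵥ G)
    let v0 : Fin ν → ZMod q := T2 *ᵥ x0
    let y' : ℕ → ZMod q := fun t => y t + g⁻¹ * (ψ ⬝ᵥ ((F1 ^ t) *ᵥ (T1 *ᵥ x0)))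
    (∀ t, out q n F G H J x0 y t = out q n F G H J (V2 *ᵥ v0) y' t) ∧
    (∀ (w0 : Fin ν → ZMod q) (w : ℕ → ZMod q),
      (∀ t, out q n F G H J x0 y t = out q n F G H J (V2 *ᵥ w0) w t) →
      w0 = v0 ∧ ∀ t, w t = y' t) := by
  intro F1 ψ g v0 y'
  have : Fact q.Prime := ⟨hq⟩
  have hg : g ≠ 0 := hlast
  have hT2_apply (x : Fin n → ZMod q) (i : Fin ν) :
      (T2 *ᵥ x) i = H ⬝ᵥ (F ^ (i : ℕ) *ᵥ x) := by
    rw [dotProduct_mulVec, ← funext (hT2 i)]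
    rfl
  have hT2_zero (x : Fin n → ZMod q) :
      (∀ i < ν, H ⬝ᵥ (F ^ i *ᵥ x) = 0) ↔ T2 *ᵥ x = 0 := by
    simp only [funext_iff, hT2_apply, Fin.forall_iff, Pi.zero_apply]
  have hV (x : Fin n → ZMod q) (hx : ∀ i < ν, H ⬝ᵥ (F ^ i *ᵥ x) = 0) :
      V1 *ᵥ (T1 *ᵥ x) = x := by
    have h := congrArg (· *ᵥ x) hVT
    simpa [add_mulVec, ← mulVec_mulVec, (hT2_zero x).1 hx] using h
  have hT1_sub (w0 : Fin ν → ZMod q) : T1 *ᵥ (x0 - V2 *ᵥ w0) = T1 *ᵥ x0 := by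
    simp [mulVec_sub, hT1V2]
  have hT2_sub (w0 : Fin ν → ZMod q) : T2 *ᵥ (x0 - V2 *ᵥ w0) = T2 *ᵥ x0 - w0 := by
    simp [mulVec_sub, hT2V2]
  have hd (w0 : Fin ν → ZMod q) (w : ℕ → ZMod q) :=
    traj_sub_succ q n F G x0 (V2 *ᵥ w0) y w
  have hout_iff (w0 : Fin ν → ZMod q) (w : ℕ → ZMod q) (t : ℕ) :
      out q n F G H J x0 y t = out q n F G H J (V2 *ᵥ w0) w t ↔
        H ⬝ᵥ (traj q n F G x0 y t - traj q n F G (V2 *ᵥ w0) w t) = 0 := by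
    simp [out, hJ, dotProduct_sub, sub_eq_zero]
  simp only [hout_iff]
  refine ⟨output_eq_zero_of_input_eq (d := fun t => _) (e := fun t => y t - y' t)
    (hd v0 y') hν hzero hT1G hV ?_ fun t => ?_, fun w0 w hw => ⟨?_, fun t => ?_⟩⟩
  · exact (hT2_zero _).2 ((hT2_sub v0).trans (sub_self _))
  · change (y t - (y t + g⁻¹ * (ψ ⬝ᵥ (F1 ^ t *ᵥ (T1 *ᵥ x0))))) * g =
      -(ψ ⬝ᵥ (F1 ^ t *ᵥ (T1 *ᵥ (x0 - V2 *ᵥ v0))))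
    rw [hT1_sub]
    field_simp
    ring
  · have h := (hT2_zero _).1 fun i hi =>
      dotProduct_pow_mulVec_eq_zero (d := fun t => _) (e := fun t => y t - w t)
        (hd w0 w) hzero hw hi 0
    exact (sub_eq_zero.1 ((hT2_sub w0).symm.trans h)).symm
  · have h : (y t - w t) * g = -(ψ ⬝ᵥ (F1 ^ t *ᵥ (T1 *ᵥ (x0 - V2 *ᵥ w0)))) :=
      input_eq_of_output_eq_zero (d := fun t => _) (e := fun t => y t - w t)
        (hd w0 w) hν hzero hT1G hV hw t
    rw [hT1_sub] at h
    change w t = y t + g⁻¹ * (ψ ⬝ᵥ (F1 ^ t *ᵥ (T1 *ᵥ x0)))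
    field_simp
    linear_combination -h
end

section
/- (Lemma 2.) Suppose J ≢ 0 (mod q) (relative degree ν = 0) and let J^{−1} ∈ Z_q be the multiplicative inverse of J. For any initial state x_0 ∈ Z_q^n and input sequence y: Z_{≥0} → Z_q, there exists a unique sequence y': Z_{≥0} → Z_q such that S(x_0, {y(τ)}_{τ=0}^{t}) = S(0, {y'(τ)}_{τ=0}^{t}) for all t ≥ 0; moreover it is given by y'(t) = y(t) + J^{−1}·H·(F − G·J^{−1}·H)^t·x_0 mod q for all t ≥ 0. -/
open Matrix

/-- The trajectory up to time `t` depends only on the inputs strictly before `t`. -/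
lemma traj_congr {q n : ℕ} (F : Matrix (Fin n) (Fin n) (ZMod q)) (G x0 : Fin n → ZMod q)
    {y w : ℕ → ZMod q} {t : ℕ} (h : ∀ s < t, y s = w s) :
    traj q n F G x0 y t = traj q n F G x0 w t := by
  induction t with
  | zero => rfl
  | succ t ih =>
    simp only [traj, ih fun s hs => h s (hs.trans t.lt_succ_self), h t t.lt_succ_self]

/-- If `J` is left-cancellable, the output sequence determines the input sequence. -/
lemma out_injective {q n : ℕ} (F : Matrix (Fin n) (Fin n) (ZMod q)) (G H : Fin n → ZMod q)
    {J : ZMod q} (hJ : IsLeftRegular J) (x0 : Fin n → ZMod q) :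
    Function.Injective (out q n F G H J x0) := by
  intro y w h
  funext t
  induction t using Nat.strong_induction_on with
  | _ t ih =>
    have ht := congrFun h t
    simp only [out, traj_congr F G x0 ih] at ht
    exact hJ (add_left_cancel ht)

/-- Transferring the initial state to the input by closed-loop feedback with gain `k`. -/
lemma traj_zero_add_feedback {q n : ℕ} (F : Matrix (Fin n) (Fin n) (ZMod q))
    (G H x0 : Fin n → ZMod q) (k : ZMod q) (y : ℕ → ZMod q) (t : ℕ) :
    traj q n F G 0 (fun s => y s + k * (H ⬝ᵥ ((F - k • vecMulVec G H) ^ s *ᵥ x0))) t +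
      (F - k • vecMulVec G H) ^ t *ᵥ x0 = traj q n F G x0 y t := by
  induction t with
  | zero => simp [traj]
  | succ t ih =>
    simp only [traj, ← ih, pow_succ', ← mulVec_mulVec, mulVec_add]
    generalize (F - k • vecMulVec G H) ^ t *ᵥ x0 = d
    rw [sub_mulVec, smul_mulVec, vecMulVec_mulVec, op_smul_eq_smul, smul_smul, add_smul]
    abel

/-- Lemma 2: if `J ≠ 0` (relative degree `ν = 0`), there exists a unique
input `y'` such that `S(x₀, y) = S(0, y')`, given by
`y'(t) = y(t) + J⁻¹ H (F - G J⁻¹ H)ᵗ x₀`. -/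
theorem equivalent_input_relative_degree_zero
    (q n : ℕ) (hq : Nat.Prime q)
    (F : Matrix (Fin n) (Fin n) (ZMod q)) (G H : Fin n → ZMod q) (J : ZMod q)
    (hJ : J ≠ 0)
    (x0 : Fin n → ZMod q) (y : ℕ → ZMod q) :
    let Fcl : Matrix (Fin n) (Fin n) (ZMod q) := F - J⁻¹ • vecMulVec G H
    let y' : ℕ → ZMod q := fun t => y t + J⁻¹ * (H ⬝ᵥ ((Fcl ^ t) *ᵥ x0))
    (∀ t, out q n F G H J x0 y t = out q n F G H J 0 y' t) ∧
    (∀ w : ℕ → ZMod q,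
      (∀ t, out q n F G H J x0 y t = out q n F G H J 0 w t) →
      ∀ t, w t = y' t) := by
  intro Fcl y'
  have := Fact.mk hq
  have hy (t : ℕ) : out q n F G H J x0 y t = out q n F G H J 0 y' t := by
    simp only [out, ← traj_zero_add_feedback F G H x0 J⁻¹ y t, dotProduct_add, y', Fcl,
      mul_add, mul_inv_cancel_left₀ hJ]
    ring
  refine ⟨hy, fun w hw => congrFun (out_injective F G H (mul_right_injective₀ hJ) 0 ?_)⟩
  funext t
  exact (hw t).symm.trans (hy t)
end

section
/- (Theorem 1, case ν ≥ 1.) Let the system over Z_q have relative degree ν ≥ 1 and adopt the coordinate-change data T_1, T_2, V_1, V_2, with F_1 = T_1·F·V_1 mod q, ψ = H·F^ν·V_1 mod q, and g = H·F^{ν−1}·G mod q. Let x_0 ∈ Z_q^n and y: Z_{≥0} → Z_q be a message initial state and input sequence, and let B_x ∈ Z_q^n and B_y: Z_{≥0} → Z_q be arbitrary masking values. Then there exist a unique v_0 ∈ Z_q^ν and a unique sequence y': Z_{≥0} → Z_q such that S(x_0 + (B_x − V_2·v_0), {y(τ) + (B_y(τ) − y'(τ))}_{τ=0}^{t}) =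 S(x_0, {y(τ)}_{τ=0}^{t}) for all t ≥ 0; moreover they are given by v_0 = T_2·B_x mod q and y'(t) = B'_y(t) for all t ≥ 0, where B'_y(t) = B_y(t) + g^{−1}·ψ·z(t) mod q with z(t+1) = F_1·z(t) mod q and z(0) = T_1·B_x mod q. -/
open Matrix

theorem traj_add (q n : ℕ) (F : Matrix (Fin n) (Fin n) (ZMod q)) (G a b : Fin n → ZMod q)
    (u w : ℕ → ZMod q) (t : ℕ) :
    traj q n F G (a + b) (fun τ => u τ + w τ) t = traj q n F G a u t + traj q n F G b w t := by
  induction t with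
  | zero => rfl
  | succ t ih =>
    simp only [traj, ih, mulVec_add, add_smul]
    abel

/-- With zero feedthrough, perturbing the initial state and the input leaves the output unchanged
iff the trajectory of the perturbation is annihilated by `H`. -/
theorem out_add_eq_iff (q n : ℕ) (F : Matrix (Fin n) (Fin n) (ZMod q))
    (G H a b : Fin n → ZMod q) (u w : ℕ → ZMod q) (t : ℕ) :
    out q n F G H 0 (a + b) (fun τ => u τ + w τ) t = out q n F G H 0 a u t ↔
      H ⬝ᵥ traj q n F G b w t = 0 := by
  simp [out, traj_add, dotProduct_add]

theorem vecMul_pow_dotProduct_step {R : Type*} [CommRing R] {n : ℕ} (F : Matrix (Fin n) (Fin n) R)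
    (G H v : Fin n → R) (c : R) (i : ℕ) :
    (H ᵥ* F ^ i) ⬝ᵥ (F *ᵥ v + c • G) =
      (H ᵥ* F ^ (i + 1)) ⬝ᵥ v + c * (H ⬝ᵥ (F ^ i *ᵥ G)) := by
  rw [dotProduct_add, dotProduct_smul, dotProduct_mulVec, vecMul_vecMul, ← pow_succ,
    ← dotProduct_mulVec H (F ^ i) G, smul_eq_mul]

/-- Theorem 1, case ν ≥ 1: there exist unique `v₀` and `y'` with
`S(x₀ + (Bₓ − V₂ v₀), y + (B_y − y')) = S(x₀, y)` for all `t`; they are given by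
`v₀ = T₂ Bₓ` and `y'(t) = B'_y(t) = B_y(t) + g⁻¹ ψ z(t)`, where
`z(t+1) = F₁ z(t)`, `z(0) = T₁ Bₓ`. -/
theorem modified_encryption_discloses_residue_nu_ge_one
    (q n ν : ℕ) (hq : Nat.Prime q) (hν : 1 ≤ ν) (hνn : ν ≤ n)
    (F : Matrix (Fin n) (Fin n) (ZMod q)) (G H : Fin n → ZMod q) (J : ZMod q)
    (hJ : J = 0)
    (hlast : H ⬝ᵥ ((F ^ (ν - 1)) *ᵥ G) ≠ 0)
    (hzero : ∀ i : ℕ, i + 2 ≤ ν → H ⬝ᵥ ((F ^ i) *ᵥ G) = 0)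
    (T1 : Matrix (Fin (n - ν)) (Fin n) (ZMod q))
    (T2 : Matrix (Fin ν) (Fin n) (ZMod q))
    (V1 : Matrix (Fin n) (Fin (n - ν)) (ZMod q))
    (V2 : Matrix (Fin n) (Fin ν) (ZMod q))
    (hT2 : ∀ (i : Fin ν) (j : Fin n), T2 i j = (H ᵥ* F ^ (i : ℕ)) j)
    (hT1G : T1 *ᵥ G = 0)
    (hT1V1 : T1 * V1 = 1) (hT1V2 : T1 * V2 = 0)
    (hT2V1 : T2 * V1 = 0) (hT2V2 : T2 * V2 = 1)
    (hVT : V1 * T1 + V2 * T2 = 1)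
    (x0 Bx : Fin n → ZMod q) (y By : ℕ → ZMod q)
    (z : ℕ → Fin (n - ν) → ZMod q)
    (hz0 : z 0 = T1 *ᵥ Bx)
    (hzrec : ∀ t, z (t + 1) = (T1 * F * V1) *ᵥ z t) :
    let ψ : Fin (n - ν) → ZMod q := (H ᵥ* F ^ ν) ᵥ* V1
    let g : ZMod q := H ⬝ᵥ ((F ^ (ν - 1)) *ᵥ G)
    let By' : ℕ → ZMod q := fun t => By t + g⁻¹ * (ψ ⬝ᵥ z t)
    (∀ t, out q n F G H J (x0 + (Bx - V2 *ᵥ (T2 *ᵥ Bx)))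
        (fun τ => y τ + (By τ - By' τ)) t = out q n F G H J x0 y t) ∧
    (∀ (v0 : Fin ν → ZMod q) (y' : ℕ → ZMod q),
      (∀ t, out q n F G H J (x0 + (Bx - V2 *ᵥ v0))
        (fun τ => y τ + (By τ - y' τ)) t = out q n F G H J x0 y t) →
      v0 = T2 *ᵥ Bx ∧ ∀ t, y' t = By' t) := by
  subst hJ
  intro ψ g By'
  have := Fact.mk hq
  have hg : g ≠ 0 := hlast
  have hrow : ∀ (v : Fin n → ZMod q) (i : Fin ν),
      (T2 *ᵥ v) i = (H ᵥ* F ^ (i : ℕ)) ⬝ᵥ v := fun v i =>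
    congrArg (· ⬝ᵥ v) (funext (hT2 i))
  have hsplit : ∀ v : Fin n → ZMod q, V1 *ᵥ (T1 *ᵥ v) + V2 *ᵥ (T2 *ᵥ v) = v := fun v => by
    rw [mulVec_mulVec, mulVec_mulVec, ← add_mulVec, hVT, one_mulVec]
  have hψ : ∀ w : Fin (n - ν) → ZMod q, (H ᵥ* F ^ ν) ⬝ᵥ (V1 *ᵥ w) = ψ ⬝ᵥ w := fun w => dotProduct_mulVec _ _ _
  have hT2V1z : ∀ w : Fin (n - ν) → ZMod q, T2 *ᵥ (V1 *ᵥ w) = 0 := fun w => by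
    rw [mulVec_mulVec, hT2V1, zero_mulVec]
  have hT1step : ∀ (w : Fin (n - ν) → ZMod q) (c : ZMod q),
      T1 *ᵥ (F *ᵥ (V1 *ᵥ w) + c • G) = (T1 * F * V1) *ᵥ w := fun w c => by
    rw [mulVec_add, mulVec_smul, hT1G, smul_zero, add_zero, mulVec_mulVec, mulVec_mulVec,
      Matrix.mul_assoc]
  refine ⟨fun t => ?_, fun v0 y' h => ?_⟩
  · rw [out_add_eq_iff]
    have hd : ∀ t, traj q n F G (Bx - V2 *ᵥ (T2 *ᵥ Bx)) (fun τ => By τ - By' τ) t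
        = V1 *ᵥ z t := by
      intro t
      induction t with
      | zero =>
        rw [traj, hz0, sub_eq_iff_eq_add]
        exact (hsplit Bx).symm
      | succ t ih =>
        rw [traj, ih, ← hsplit (F *ᵥ (V1 *ᵥ z t) + _), hT1step, ← hzrec]
        suffices hT : T2 *ᵥ (F *ᵥ (V1 *ᵥ z t) + (By t - By' t) • G) = 0 by
          rw [hT, mulVec_zero, add_zero]
        funext i
        rw [hrow, vecMul_pow_dotProduct_step]
        rcases Nat.lt_or_ge (i + 1) ν with hi | hi
        · rw [hzero i (by lia), ← hrow _ ⟨i + 1, hi⟩, hT2V1z]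
          simp
        · have hi' : (i : ℕ) + 1 = ν := by lia
          have hi'' : (i : ℕ) = ν - 1 := by lia
          rw [hi', hi'', hψ]
          change ψ ⬝ᵥ z t + (By t - (By t + g⁻¹ * (ψ ⬝ᵥ z t))) * g = 0
          field_simp
          ring
    have h0 := hrow (V1 *ᵥ z t) ⟨0, hν⟩
    rw [hT2V1z] at h0
    rw [hd]
    simpa using h0.symm
  · simp only [out_add_eq_iff] at h
    set d := traj q n F G (Bx - V2 *ᵥ v0) (fun τ => By τ - y' τ) with hd
    have hsucc : ∀ t, d (t + 1) = F *ᵥ d t + (By t - y' t) • G := fun t => rfl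
    have hpow : ∀ i, i < ν → ∀ t, (H ᵥ* F ^ i) ⬝ᵥ d t = 0 := by
      intro i
      induction i with
      | zero => intro _ t; simpa using h t
      | succ i ih =>
        intro hi t
        have := ih (by lia) (t + 1)
        rwa [hsucc, vecMul_pow_dotProduct_step, hzero i (by lia), mul_zero, add_zero] at this
    have hT2d : ∀ t, T2 *ᵥ d t = 0 := fun t => funext fun i => by
      rw [hrow, hpow i i.2]; rfl
    have hdV : ∀ t, d t = V1 *ᵥ (T1 *ᵥ d t) := fun t => by
      conv_lhs => rw [← hsplit (d t), hT2d, mulVec_zero, add_zero]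
    have hdz : ∀ t, T1 *ᵥ d t = z t := by
      intro t
      induction t with
      | zero =>
        change T1 *ᵥ (Bx - V2 *ᵥ v0) = z 0
        rw [hz0, mulVec_sub, mulVec_mulVec, hT1V2, zero_mulVec, sub_zero]
      | succ t ih => rw [hsucc, hdV, ih, hT1step, hzrec]
    refine ⟨?_, fun t => ?_⟩
    · have h0 : T2 *ᵥ (Bx - V2 *ᵥ v0) = 0 := hT2d 0
      rw [mulVec_sub, mulVec_mulVec, hT2V2, one_mulVec, sub_eq_zero] at h0
      exact h0.symm
    · have h1 := hpow (ν - 1) (by lia) (t + 1)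
      rw [hsucc, vecMul_pow_dotProduct_step, Nat.sub_add_cancel hν, hdV, hdz, hψ] at h1
      change ψ ⬝ᵥ z t + (By t - y' t) * g = 0 at h1
      change y' t = By t + g⁻¹ * (ψ ⬝ᵥ z t)
      field_simp
      linear_combination -h1
end
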